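/- arXiv:2504.07847 — 2 statements merged into one kernel-verified Lean document; each statement's English description precedes it below -/
import Mathlib

section
/- Let A ∈ ℝ^{n×n}, C ∈ ℝ^{m×n}, and let Q ∈ ℝ^{n×n} and R ∈ ℝ^{m×m} be symmetric positive definite. Let (θ_t)_{t≥0} be a sequence of nonnegative reals and let (P_t)_{t≥0} and (P̄_t)_{t≥0} be sequences of n×n real symmetric matrices satisfying P_{t+1} = A(P_t⁻¹ + CᵀR⁻¹C − θ_t I)⁻¹Aᵀ + Q and P̄_{t+1} = A(P̄_t⁻¹ + CᵀR⁻¹C)⁻¹Aᵀ + Q for all t, with P̄₀ positive definite, P̄₀ ⪯ P₀, and such that P_t⁻¹ + CᵀR⁻¹C − θ_t I is positive definite for every t. Then for every t ≥ 0, P̄_t is positive definite and P̄_t ⪯ P_t. -/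
open Matrix

/-- Inversion is antitone on positive definite matrices. -/
theorem Matrix.PosDef.posSemidef_inv_sub_inv {ι : Type*} [Fintype ι] [DecidableEq ι]
    {X Y : Matrix ι ι ℝ} (hX : X.PosDef) (hY : Y.PosDef) (h : (X - Y).PosSemidef) :
    (Y⁻¹ - X⁻¹).PosSemidef := by
  have := hX.isUnit.invertible
  have := hY.inv.isUnit.invertible
  have hdet : IsUnit Y.det := (Matrix.isUnit_iff_isUnit_det Y).mp hY.isUnit
  have hblock : (fromBlocks X 1 1ᴴ Y⁻¹).PosSemidef := by
    rw [Matrix.PosDef.fromBlocks₂₂ X 1 hY.inv]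
    simpa [Matrix.nonsing_inv_nonsing_inv Y hdet] using h
  simpa using (Matrix.PosDef.fromBlocks₁₁ 1 Y⁻¹ hX).mp hblock

theorem stmt_6 {n m : ℕ} (A Q : Matrix (Fin n) (Fin n) ℝ)
    (C : Matrix (Fin m) (Fin n) ℝ) (R : Matrix (Fin m) (Fin m) ℝ)
    (hQsym : Q.IsSymm) (hQ : Q.PosDef) (hRsym : R.IsSymm) (hR : R.PosDef)
    (θ : ℕ → ℝ) (hθ : ∀ t, 0 ≤ θ t)
    (P Pbar : ℕ → Matrix (Fin n) (Fin n) ℝ)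
    (hPsym : ∀ t, (P t).IsSymm) (hPbarsym : ∀ t, (Pbar t).IsSymm)
    (hPrec : ∀ t, P (t + 1) = A * ((P t)⁻¹ + Cᵀ * R⁻¹ * C - θ t • 1)⁻¹ * Aᵀ + Q)
    (hPbarrec : ∀ t, Pbar (t + 1) = A * ((Pbar t)⁻¹ + Cᵀ * R⁻¹ * C)⁻¹ * Aᵀ + Q)
    (hPbar0 : (Pbar 0).PosDef) (h0 : (P 0 - Pbar 0).PosSemidef)
    (hpd : ∀ t, ((P t)⁻¹ + Cᵀ * R⁻¹ * C - θ t • 1).PosDef) :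
    ∀ t, (Pbar t).PosDef ∧ (P t - Pbar t).PosSemidef := by
  intro t
  induction t with
  | zero => exact ⟨hPbar0, h0⟩
  | succ t ih =>
    obtain ⟨hbar, hle⟩ := ih
    have hP : (P t).PosDef := by simpa using hbar.add_posSemidef hle
    have hdiff : (((Pbar t)⁻¹ + Cᵀ * R⁻¹ * C) -
        ((P t)⁻¹ + Cᵀ * R⁻¹ * C - θ t • 1)).PosSemidef := by
      convert (hP.posSemidef_inv_sub_inv hbar hle).add (PosSemidef.one.smul (hθ t)) using 1
      abel
    have hbarpd : ((Pbar t)⁻¹ + Cᵀ * R⁻¹ * C).PosDef := by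
      simpa using (hpd t).add_posSemidef hdiff
    rw [hPbarrec, hPrec]
    refine ⟨PosDef.posSemidef_add ?_ hQ, ?_⟩
    · simpa using hbarpd.inv.posSemidef.mul_mul_conjTranspose_same A
    · rw [add_sub_add_right_eq_sub, ← Matrix.sub_mul, ← Matrix.mul_sub]
      simpa using (hbarpd.posSemidef_inv_sub_inv (hpd t) hdiff).mul_mul_conjTranspose_same A
end

section
/- Let A ∈ ℝ^{n×n}, C ∈ ℝ^{m×n}, G ∈ ℝ^{n×m}, and let Q ∈ ℝ^{n×n} and R ∈ ℝ^{m×m} be symmetric positive definite. Let α ∈ (0, 1] and ρ > 1, and let Σ be an n×n real symmetric positive definite matrix satisfying Σ = ρ²(A − αGC)Σ(A − αGC)ᵀ + GRGᵀ + Q. Define β := λ_min(((ρ² − 1)/ρ²)·Σ⁻¹ + (1 − α²)·CᵀR⁻¹C) and let 0 ≤ θ ≤ β. Then Σ⁻¹ + CᵀR⁻¹C − θI is positive definite and A(Σ⁻¹ + CᵀR⁻¹C − θI)⁻¹Aᵀ + Q ⪯ Σ. -/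
open Matrix

/-- The smallest eigenvalue (spectral value) of a real matrix. -/
noncomputable def lambdaMin {n : ℕ} (M : Matrix (Fin n) (Fin n) ℝ) : ℝ :=
  sInf (spectrum ℝ M)

theorem Matrix.IsHermitian.posSemidef_sub_smul_one_of_le_lambdaMin {n : ℕ}
    {M : Matrix (Fin n) (Fin n) ℝ} (hM : M.IsHermitian) {t : ℝ} (ht : t ≤ lambdaMin M) :
    (M - t • 1).PosSemidef := by
  have hbdd : BddBelow (spectrum ℝ M) := M.finite_real_spectrum.bddBelow
  have hherm : (M - t • 1).IsHermitian := hM.sub (isHermitian_one.smul (IsSelfAdjoint.all t))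
  refine posSemidef_iff_isHermitian_and_spectrum_nonneg.2 ⟨hherm, fun s hs => ?_⟩
  have hmem : s + t ∈ spectrum ℝ M := by
    rw [add_comm]
    have h := spectrum.add_mem_add_iff (a := M - t • 1) (r := s) (s := t)
    rw [Algebra.algebraMap_eq_smul_one] at h
    simpa [add_comm] using h.2 hs
  have hle := ht.trans (csInf_le hbdd hmem)
  simpa using hle

/-- Young's inequality weighted by a positive definite matrix. -/
theorem Matrix.PosDef.two_mul_dotProduct_le {ι : Type*} [Fintype ι] [DecidableEq ι]
    {P : Matrix ι ι ℝ} (hP : P.PosDef) (a b : ι → ℝ) :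
    2 * (a ⬝ᵥ b) ≤ a ⬝ᵥ (P *ᵥ a) + b ⬝ᵥ (P⁻¹ *ᵥ b) := by
  have hnonneg := hP.posSemidef.dotProduct_mulVec_nonneg (a - P⁻¹ *ᵥ b)
  have hcancel : P *ᵥ (P⁻¹ *ᵥ b) = b := by
    rw [mulVec_mulVec, mul_nonsing_inv _ ((isUnit_iff_isUnit_det P).1 hP.isUnit), one_mulVec]
  have htranspose : Pᵀ = P := by
    simpa [conjTranspose_eq_transpose_of_trivial] using hP.isHermitian.eq
  have hcross : (P⁻¹ *ᵥ b) ⬝ᵥ (P *ᵥ a) = a ⬝ᵥ b := by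
    rw [dotProduct_mulVec, ← mulVec_transpose, htranspose, hcancel, dotProduct_comm]
  have hcomm : (P⁻¹ *ᵥ b) ⬝ᵥ b = b ⬝ᵥ (P⁻¹ *ᵥ b) := dotProduct_comm _ _
  simp only [star_trivial, mulVec_sub, sub_dotProduct, dotProduct_sub, hcancel, hcross,
    hcomm] at hnonneg
  linarith

theorem Matrix.IsHermitian.mul_mul_transpose_same {ι κ : Type*} [Fintype ι]
    {M : Matrix ι ι ℝ} (hM : M.IsHermitian) (B : Matrix κ ι ℝ) : (B * M * Bᵀ).IsHermitian := by
  rw [← conjTranspose_eq_transpose_of_trivial]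
  exact isHermitian_mul_mul_conjTranspose B hM

theorem Matrix.dotProduct_mul_mul_transpose_mulVec {ι κ : Type*} [Fintype ι] [Fintype κ]
    (B : Matrix κ ι ℝ) (M : Matrix ι ι ℝ) (z : κ → ℝ) :
    z ⬝ᵥ ((B * M * Bᵀ) *ᵥ z) = (Bᵀ *ᵥ z) ⬝ᵥ (M *ᵥ (Bᵀ *ᵥ z)) := by
  rw [← mulVec_mulVec, ← mulVec_mulVec, dotProduct_mulVec, ← mulVec_transpose]

/-- If `S⁻¹ + Cᵀ R⁻¹ C ≤ N` in the Loewner order, then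
`(F + G C) N⁻¹ (F + G C)ᵀ ≤ F S Fᵀ + G R Gᵀ`. -/
theorem Matrix.PosDef.posSemidef_add_sub_of_posSemidef_sub {ι κ : Type*} [Fintype ι]
    [DecidableEq ι] [Fintype κ] [DecidableEq κ] {S N : Matrix ι ι ℝ} {R : Matrix κ κ ℝ}
    (hS : S.PosDef) (hR : R.PosDef) (hN : N.PosDef) (F : Matrix ι ι ℝ) (G : Matrix ι κ ℝ)
    (C : Matrix κ ι ℝ) (hle : (N - (S⁻¹ + Cᵀ * R⁻¹ * C)).PosSemidef) :
    (F * S * Fᵀ + G * R * Gᵀ - (F + G * C) * N⁻¹ * (F + G * C)ᵀ).PosSemidef := by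
  refine .of_dotProduct_mulVec_nonneg (((hS.isHermitian.mul_mul_transpose_same F).add
    (hR.isHermitian.mul_mul_transpose_same G)).sub
      (hN.inv.isHermitian.mul_mul_transpose_same _)) fun x => ?_
  set y := N⁻¹ *ᵥ ((F + G * C)ᵀ *ᵥ x) with hy
  have hNy : N *ᵥ y = (F + G * C)ᵀ *ᵥ x := by
    rw [hy, mulVec_mulVec, mul_nonsing_inv _ ((isUnit_iff_isUnit_det N).1 hN.isUnit), one_mulVec]
  have hsplit : ((F + G * C)ᵀ *ᵥ x) ⬝ᵥ y = (Fᵀ *ᵥ x) ⬝ᵥ y + (Gᵀ *ᵥ x) ⬝ᵥ (C *ᵥ y) := by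
    rw [transpose_add, transpose_mul, add_mulVec, add_dotProduct, ← mulVec_mulVec,
      dotProduct_mulVec _ C, ← mulVec_transpose]
  have hlower := hle.dotProduct_mulVec_nonneg y
  have hC := dotProduct_mul_mul_transpose_mulVec Cᵀ R⁻¹ y
  rw [transpose_transpose] at hC
  rw [star_trivial, sub_mulVec, add_mulVec, dotProduct_sub, dotProduct_add, hC, hNy,
    dotProduct_comm y, hsplit] at hlower
  have hF := hS.two_mul_dotProduct_le (Fᵀ *ᵥ x) y
  have hG := hR.two_mul_dotProduct_le (Gᵀ *ᵥ x) (C *ᵥ y)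
  rw [star_trivial, sub_mulVec, add_mulVec, dotProduct_sub, dotProduct_add,
    dotProduct_mul_mul_transpose_mulVec, dotProduct_mul_mul_transpose_mulVec,
    dotProduct_mul_mul_transpose_mulVec, ← hy, hsplit]
  linarith

theorem stmt_13 {n m : ℕ} (A Q : Matrix (Fin n) (Fin n) ℝ)
    (C : Matrix (Fin m) (Fin n) ℝ) (G : Matrix (Fin n) (Fin m) ℝ)
    (R : Matrix (Fin m) (Fin m) ℝ)
    (hQsym : Q.IsSymm) (hQ : Q.PosDef) (hRsym : R.IsSymm) (hR : R.PosDef)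
    (α ρ : ℝ) (hα0 : 0 < α) (hα1 : α ≤ 1) (hρ : 1 < ρ)
    (Sig : Matrix (Fin n) (Fin n) ℝ) (hSigsym : Sig.IsSymm) (hSig : Sig.PosDef)
    (hlyap : Sig = ρ ^ 2 • ((A - α • (G * C)) * Sig * (A - α • (G * C))ᵀ) + G * R * Gᵀ + Q)
    (β : ℝ)
    (hβ : β = lambdaMin (((ρ ^ 2 - 1) / ρ ^ 2) • Sig⁻¹ + (1 - α ^ 2) • (Cᵀ * R⁻¹ * C)))
    (θ : ℝ) (hθ0 : 0 ≤ θ) (hθβ : θ ≤ β) :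
    (Sig⁻¹ + Cᵀ * R⁻¹ * C - θ • 1).PosDef ∧
    (Sig - (A * (Sig⁻¹ + Cᵀ * R⁻¹ * C - θ • 1)⁻¹ * Aᵀ + Q)).PosSemidef := by
  have hρ2 : 0 < ρ ^ 2 := by positivity
  have hK : (Cᵀ * R⁻¹ * C).PosSemidef := by
    simpa [conjTranspose_eq_transpose_of_trivial] using
      hR.inv.posSemidef.conjTranspose_mul_mul_same C
  have hM : (((ρ ^ 2 - 1) / ρ ^ 2) • Sig⁻¹ + (1 - α ^ 2) • (Cᵀ * R⁻¹ * C)).IsHermitian :=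
    (hSig.inv.isHermitian.smul (IsSelfAdjoint.all _)).add
      (hK.isHermitian.smul (IsSelfAdjoint.all _))
  have hgap := hM.posSemidef_sub_smul_one_of_le_lambdaMin (hθβ.trans_eq hβ)
  have hscaled : (ρ ^ 2 • Sig).PosDef := hSig.smul hρ2
  have hinv : (ρ ^ 2 • Sig)⁻¹ = (ρ ^ 2)⁻¹ • Sig⁻¹ := by
    refine inv_eq_left_inv ?_
    rw [smul_mul_smul_comm, inv_mul_cancel₀ hρ2.ne', one_smul,
      nonsing_inv_mul _ ((isUnit_iff_isUnit_det Sig).1 hSig.isUnit)]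
  have hαK : (α • C)ᵀ * R⁻¹ * (α • C) = α ^ 2 • (Cᵀ * R⁻¹ * C) := by
    simp [transpose_smul, smul_smul, pow_two]
  have hdecomp : Sig⁻¹ + Cᵀ * R⁻¹ * C - θ • 1 =
      ((ρ ^ 2 • Sig)⁻¹ + (α • C)ᵀ * R⁻¹ * (α • C)) +
      (((ρ ^ 2 - 1) / ρ ^ 2) • Sig⁻¹ + (1 - α ^ 2) • (Cᵀ * R⁻¹ * C) - θ • 1) := by
    rw [hinv, hαK]
    have hcoeff : (ρ ^ 2 - 1) / ρ ^ 2 = 1 - (ρ ^ 2)⁻¹ := by field_simp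
    rw [hcoeff]
    module
  have hN : (Sig⁻¹ + Cᵀ * R⁻¹ * C - θ • 1).PosDef := by
    rw [hdecomp, hαK]
    exact (hscaled.inv.add_posSemidef (hK.smul (sq_nonneg α))).add_posSemidef hgap
  refine ⟨hN, ?_⟩
  have hbound := hscaled.posSemidef_add_sub_of_posSemidef_sub hR hN (A - α • (G * C)) G (α • C)
    (by rw [hdecomp, add_sub_cancel_left]; exact hgap)
  have hA : A - α • (G * C) + G * (α • C) = A := by rw [Matrix.mul_smul, sub_add_cancel]
  rw [hA, Matrix.mul_smul, Matrix.smul_mul] at hbound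
  convert hbound using 1
  nth_rw 1 [hlyap]
  abel
end
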